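/- For any connected weighted graph G on n vertices, ρ_ss(G) ≥ (n-1) / (2 · (n·T(G))^{1/(n-1)}), where T(G) is the weighted number of spanning trees of G. -/

import Mathlib

open Matrix SimpleGraph Finset

/-- Weighted Laplacian of a graph with edge weights `w`. -/
noncomputable def glap {n : ℕ} (G : SimpleGraph (Fin n)) [DecidableRel G.Adj]
    (w : Sym2 (Fin n) → ℝ) : Matrix (Fin n) (Fin n) ℝ :=
  Matrix.of fun i j =>
    if i = j then ∑ k, (if G.Adj i k then w s(i, k) else 0)
    else if G.Adj i j then -w s(i, j) else 0

lemma glap_isHermitian {n : ℕ} (G : SimpleGraph (Fin n)) [DecidableRel G.Adj]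
    (w : Sym2 (Fin n) → ℝ) : (glap G w).IsHermitian := by
  rw [Matrix.IsHermitian, conjTranspose_eq_transpose_of_trivial]
  ext i j
  simp only [glap, Matrix.transpose_apply, Matrix.of_apply]
  by_cases h : i = j
  · subst h; simp
  · have h' : ¬ j = i := fun hh => h hh.symm
    rw [if_neg h', if_neg h]
    by_cases ha : G.Adj i j
    · rw [if_pos ha, if_pos (G.adj_comm i j |>.mp ha), Sym2.eq_swap]
    · rw [if_neg ha, if_neg (fun hh => ha ((G.adj_comm i j).mpr hh))]

/-- Eigenvalues of the weighted Laplacian. -/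
noncomputable def wEig {n : ℕ} (G : SimpleGraph (Fin n)) [DecidableRel G.Adj]
    (w : Sym2 (Fin n) → ℝ) : Fin n → ℝ :=
  (glap_isHermitian G w).eigenvalues

/-- Performance measure of a weighted graph. -/
noncomputable def wRho {n : ℕ} (G : SimpleGraph (Fin n)) [DecidableRel G.Adj]
    (w : Sym2 (Fin n) → ℝ) : ℝ :=
  (1/2) * ∑ i, (wEig G w i)⁻¹

open Classical in
/-- Weighted number of spanning trees: the sum over all spanning trees of the product of
their edge weights. -/
noncomputable def treeCount {n : ℕ} (G : SimpleGraph (Fin n)) (w : Sym2 (Fin n) → ℝ) : ℝ :=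
  ∑ H ∈ (Finset.univ : Finset (SimpleGraph (Fin n))),
    if H ≤ G ∧ H.IsTree then ∏ e ∈ H.edgeFinset, w e else 0

/-- Edge coefficient. -/
noncomputable def cw {n : ℕ} (G : SimpleGraph (Fin n)) [DecidableRel G.Adj]
    (w : Sym2 (Fin n) → ℝ) (i k : Fin n) : ℝ := if G.Adj i k then w s(i, k) else 0

/-- The map `f` decreases some rank off the root `r`. -/
def Ranked {n : ℕ} (r : Fin n) (f : Fin n → Fin n) : Prop :=
  ∃ d : Fin n → ℕ, ∀ i, i ≠ r → d (f i) < d i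

/-- Row vectors for the pointer map `f` rooted at `r`. -/
def rowV {n : ℕ} (r : Fin n) (i k : Fin n) : Fin n → ℝ :=
  if i = r then Pi.single r 1 else Pi.single i 1 - Pi.single k 1

/-- Coefficients of the expansion. -/
noncomputable def coefC {n : ℕ} (G : SimpleGraph (Fin n)) [DecidableRel G.Adj]
    (w : Sym2 (Fin n) → ℝ) (r : Fin n) (i k : Fin n) : ℝ :=
  if i = r then (if k = r then 1 else 0) else cw G w i k

/-- The graph of pointers. -/
def ptrGraph {n : ℕ} (r : Fin n) (f : Fin n → Fin n) : SimpleGraph (Fin n) :=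
  SimpleGraph.fromEdgeSet {e | ∃ i, i ≠ r ∧ s(i, f i) = e}

section
variable {n : ℕ}

lemma cw_symm (G : SimpleGraph (Fin n)) [DecidableRel G.Adj]
    (w : Sym2 (Fin n) → ℝ) (i k : Fin n) : cw G w i k = cw G w k i := by
  simp only [cw, G.adj_comm i k, Sym2.eq_swap (a := i)]

lemma cw_nonneg (G : SimpleGraph (Fin n)) [DecidableRel G.Adj]
    (w : Sym2 (Fin n) → ℝ) (hw : ∀ e ∈ G.edgeSet, 0 < w e) (i k : Fin n) : 0 ≤ cw G w i k := by
  unfold cw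
  split_ifs with h
  · exact (hw _ h).le
  · exact le_rfl

lemma glap_row (G : SimpleGraph (Fin n)) [DecidableRel G.Adj]
    (w : Sym2 (Fin n) → ℝ) (i : Fin n) :
    glap G w i = ∑ k, cw G w i k • ((Pi.single i 1 - Pi.single k 1 : Fin n → ℝ)) := by
  ext j
  simp only [glap, Matrix.of_apply, Finset.sum_apply, Pi.smul_apply, Pi.sub_apply, smul_eq_mul,
    mul_sub, Finset.sum_sub_distrib]
  have h2 : ∑ k, cw G w i k * (Pi.single k 1 : Fin n → ℝ) j = cw G w i j := by
    simp [Pi.single_apply]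
  rw [h2]
  by_cases h : i = j
  · subst h; simp [cw]
  · have h' : ¬ j = i := fun hh => h hh.symm
    simp only [h, if_false, Pi.single_apply, h', mul_zero, Finset.sum_const_zero, zero_sub, cw]
    split_ifs <;> simp

lemma glap_mulVec (G : SimpleGraph (Fin n)) [DecidableRel G.Adj]
    (w : Sym2 (Fin n) → ℝ) (x : Fin n → ℝ) (i : Fin n) :
    (glap G w *ᵥ x) i = ∑ k, cw G w i k * (x i - x k) := by
  change (glap G w i) ⬝ᵥ x = _
  rw [glap_row, sum_dotProduct]
  refine Finset.sum_congr rfl fun k _ => ?_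
  rw [smul_dotProduct, sub_dotProduct]
  simp

lemma glap_quad (G : SimpleGraph (Fin n)) [DecidableRel G.Adj]
    (w : Sym2 (Fin n) → ℝ) (x : Fin n → ℝ) :
    2 * (x ⬝ᵥ glap G w *ᵥ x) = ∑ i, ∑ k, cw G w i k * (x i - x k) ^ 2 := by
  have h1 : x ⬝ᵥ glap G w *ᵥ x = ∑ i, ∑ k, cw G w i k * (x i * (x i - x k)) := by
    simp only [dotProduct, glap_mulVec, Finset.mul_sum]
    exact Finset.sum_congr rfl fun i _ => Finset.sum_congr rfl fun k _ => by ring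
  have h2 : x ⬝ᵥ glap G w *ᵥ x = ∑ i, ∑ k, cw G w i k * (x k * (x k - x i)) := by
    rw [h1, Finset.sum_comm]
    exact Finset.sum_congr rfl fun i _ => Finset.sum_congr rfl fun k _ => by rw [cw_symm]
  rw [two_mul]
  nth_rewrite 1 [h1]
  rw [h2, ← Finset.sum_add_distrib]
  refine Finset.sum_congr rfl fun i _ => ?_
  rw [← Finset.sum_add_distrib]
  exact Finset.sum_congr rfl fun k _ => by ring

lemma glap_psd (G : SimpleGraph (Fin n)) [DecidableRel G.Adj]
    (w : Sym2 (Fin n) → ℝ) (hw : ∀ e ∈ G.edgeSet, 0 < w e) : (glap G w).PosSemidef := by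
  refine Matrix.PosSemidef.of_dotProduct_mulVec_nonneg (glap_isHermitian G w) fun x => ?_
  have h := glap_quad G w x
  have h2 : 0 ≤ ∑ i, ∑ k, cw G w i k * (x i - x k) ^ 2 :=
    Finset.sum_nonneg fun i _ => Finset.sum_nonneg fun k _ =>
      mul_nonneg (cw_nonneg G w hw i k) (sq_nonneg _)
  rw [star_trivial]
  linarith

lemma glap_ker (G : SimpleGraph (Fin n)) [DecidableRel G.Adj]
    (w : Sym2 (Fin n) → ℝ) (hw : ∀ e ∈ G.edgeSet, 0 < w e) (hG : G.Connected)
    (x : Fin n → ℝ) (hx : glap G w *ᵥ x = 0) (i j : Fin n) : x i = x j := by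
  have h := glap_quad G w x
  rw [hx, dotProduct_zero, mul_zero] at h
  have h1 : ∀ i k, cw G w i k * (x i - x k) ^ 2 = 0 := by
    have hn : ∀ i k, 0 ≤ cw G w i k * (x i - x k) ^ 2 := fun i k =>
      mul_nonneg (cw_nonneg G w hw i k) (sq_nonneg _)
    intro i k
    have h3 := (Finset.sum_eq_zero_iff_of_nonneg
      (fun i _ => Finset.sum_nonneg fun k _ => hn i k)).1 h.symm i (Finset.mem_univ _)
    exact (Finset.sum_eq_zero_iff_of_nonneg (fun k _ => hn i k)).1 h3 k (Finset.mem_univ _)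
  have hadj : ∀ i k, G.Adj i k → x i = x k := by
    intro i k hik
    have := h1 i k
    rw [cw, if_pos hik] at this
    have hpos := hw _ ((G.mem_edgeSet).2 hik)
    rcases mul_eq_zero.1 this with h0 | h0
    · exact absurd h0 hpos.ne'
    · exact sub_eq_zero.1 (pow_eq_zero_iff (two_ne_zero) |>.1 h0)
  obtain ⟨p⟩ := hG.preconnected i j
  induction p with
  | nil => rfl
  | cons hA _ ih => exact (hadj _ _ hA).trans ih

lemma exists_zero_eig (G : SimpleGraph (Fin n)) [DecidableRel G.Adj]
    (w : Sym2 (Fin n) → ℝ) (hG : G.Connected) : ∃ i, wEig G w i = 0 := by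
  have hne : Nonempty (Fin n) := hG.nonempty
  have hdet : (glap G w).det = 0 := by
    refine Matrix.exists_mulVec_eq_zero_iff.1 ⟨fun _ => 1, ?_, ?_⟩
    · intro h
      exact one_ne_zero (congrFun h hne.some)
    · ext i
      rw [glap_mulVec]; simp
  rw [(glap_isHermitian G w).det_eq_prod_eigenvalues] at hdet
  obtain ⟨i, _, hi⟩ := Finset.prod_eq_zero_iff.1 hdet
  exact ⟨i, hi⟩

lemma unique_zero_eig (G : SimpleGraph (Fin n)) [DecidableRel G.Adj]
    (w : Sym2 (Fin n) → ℝ) (hw : ∀ e ∈ G.edgeSet, 0 < w e) (hG : G.Connected)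
    (i j : Fin n) (hi : wEig G w i = 0) (hj : wEig G w j = 0) : i = j := by
  by_contra hij
  set b := (glap_isHermitian G w).eigenvectorBasis with hb
  have key : ∀ k, wEig G w k = 0 → ∀ a c, (b k) a = (b k) c := by
    intro k hk a c
    refine glap_ker G w hw hG (b k).ofLp ?_ a c
    rw [hb, (glap_isHermitian G w).mulVec_eigenvectorBasis]
    change wEig G w k • _ = _
    rw [hk, zero_smul]
  have horth : inner ℝ (b i) (b j) = 0 := b.orthonormal.2 hij
  have hni : inner ℝ (b i) (b i) = (1 : ℝ) := by
    rw [real_inner_self_eq_norm_sq, b.orthonormal.1 i]; norm_num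
  have hnj : inner ℝ (b j) (b j) = (1 : ℝ) := by
    rw [real_inner_self_eq_norm_sq, b.orthonormal.1 j]; norm_num
  simp only [PiLp.inner_apply] at horth hni hnj
  rw [Finset.sum_congr rfl fun a _ => by rw [key i hi a i, key j hj a i]] at horth
  rw [Finset.sum_congr rfl fun a _ => by rw [key i hi a i]] at hni
  rw [Finset.sum_congr rfl fun a _ => by rw [key j hj a i]] at hnj
  simp at horth hni hnj
  rcases horth with h | h | h
  · subst h; exact i.elim0
  all_goals simp [h] at hni hnj

lemma trace_adj (A : Matrix (Fin n) (Fin n) ℝ) (hA : A.IsHermitian) :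
    A.adjugate.trace = ∑ i, ∏ j ∈ Finset.univ.erase i, hA.eigenvalues j := by
  have h := hA.spectral_theorem
  rw [Unitary.conjStarAlgAut_apply] at h
  have hu : star (hA.eigenvectorUnitary : Matrix (Fin n) (Fin n) ℝ) * hA.eigenvectorUnitary = 1 :=
    Unitary.coe_star_mul_self _
  conv_lhs => rw [h]
  rw [adjugate_mul_distrib, adjugate_mul_distrib, ← mul_assoc, Matrix.trace_mul_comm, ← mul_assoc,
    ← adjugate_mul_distrib, hu, adjugate_one, one_mul, adjugate_diagonal, trace_diagonal]
  rfl

lemma det_ranked (r : Fin n) (f : Fin n → Fin n) (h : Ranked r f) :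
    (Matrix.of fun i => rowV r i (f i)).det = 1 := by
  obtain ⟨d, hd⟩ := h
  have hbt : (Matrix.of fun i => rowV r i (f i)).BlockTriangular (fun i => OrderDual.toDual (d i)) := by
    intro i j hij
    have hij' : d i < d j := hij
    simp only [Matrix.of_apply, rowV]
    have hne : j ≠ i := by rintro rfl; exact lt_irrefl _ hij'
    split_ifs with hi
    · subst hi; simp [hne]
    · have := hd i hi
      have hne2 : j ≠ f i := by rintro rfl; omega
      simp [hne, hne2]
  rw [hbt.det]
  refine Finset.prod_eq_one fun a _ => ?_
  refine Eq.trans (congrArg Matrix.det ?_) Matrix.det_one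
  ext ⟨i, hi⟩ ⟨j, hj⟩
  change rowV r i (f i) j = _
  simp only [rowV, Matrix.one_apply, Subtype.mk.injEq]
  have hdij : d i = d j := by
    have := hi.trans hj.symm
    exact this
  split_ifs with h1 h2 h2
  · subst h1; subst h2; simp
  · subst h1; simp [Ne.symm h2]
  · subst h2
    have := hd i h1
    have hne2 : i ≠ f i := by intro h; rw [← h] at this; omega
    simp [hne2]
  · have := hd i h1
    have hne2 : j ≠ f i := by intro h; rw [← h] at this; omega
    simp [hne2, Ne.symm h2]

lemma det_not_ranked (r : Fin n) (f : Fin n → Fin n) (h : ¬ Ranked r f) :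
    (Matrix.of fun i => rowV r i (f i)).det = 0 := by
  classical
  have hex : ∃ i, ∀ k, f^[k] i ≠ r := by
    by_contra hcon
    push Not at hcon
    apply h
    refine ⟨fun i => Nat.find (hcon i), fun i hi => ?_⟩
    have hs := Nat.find_spec (hcon i)
    rcases hk : Nat.find (hcon i) with _ | k
    · rw [hk] at hs; exact absurd hs hi
    · rw [hk, Function.iterate_succ_apply] at hs
      have h3 := Nat.find_min' (hcon (f i)) hs
      show Nat.find (hcon (f i)) < Nat.find (hcon i)
      omega
  obtain ⟨i0, hi0⟩ := hex
  refine Matrix.exists_mulVec_eq_zero_iff.1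
    ⟨fun i => if (∀ k, f^[k] i ≠ r) then 1 else 0, ?_, ?_⟩
  · intro hz
    have := congrFun hz i0
    simp [hi0] at this
  · ext i
    change rowV r i (f i) ⬝ᵥ _ = 0
    unfold rowV
    split_ifs with hi
    · rw [single_one_dotProduct, if_neg]
      intro hk
      exact hk 0 rfl
    · rw [sub_dotProduct, single_one_dotProduct, single_one_dotProduct]
      have : (∀ k, f^[k] i ≠ r) ↔ (∀ k, f^[k] (f i) ≠ r) := by
        constructor
        · intro hk k
          rw [← Function.iterate_succ_apply]; exact hk (k+1)
        · intro hk k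
          rcases k with _ | k
          · exact hi
          · rw [Function.iterate_succ_apply]; exact hk k
      simp only [this, sub_self]

lemma adj_expand (G : SimpleGraph (Fin n)) [DecidableRel G.Adj]
    (w : Sym2 (Fin n) → ℝ) (r : Fin n) :
    (glap G w).adjugate r r = ∑ f : Fin n → Fin n,
      (∏ i, coefC G w r i (f i)) * (Matrix.of fun i => rowV r i (f i)).det := by
  rw [adjugate_apply]
  have hrow : (glap G w).updateRow r (Pi.single r 1) =
      fun i => ∑ k, coefC G w r i k • rowV r i k := by
    funext i
    by_cases hi : i = r
    · subst hi
      rw [updateRow_self]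
      simp [coefC, rowV]
    · rw [updateRow_ne hi, glap_row]
      simp [coefC, rowV, hi]
  have h1 := (Matrix.detRowAlternating (n := Fin n) (R := ℝ)).toMultilinearMap.map_sum
    (fun i k => coefC G w r i k • rowV r i k)
  rw [hrow]
  refine h1.trans (Finset.sum_congr rfl fun f _ => ?_)
  exact MultilinearMap.map_smul_univ _ (fun i => coefC G w r i (f i)) (fun i => rowV r i (f i))

lemma ranked_ne {r : Fin n} {f : Fin n → Fin n} (h : Ranked r f) {i : Fin n} (hi : i ≠ r) :
    f i ≠ i := by
  obtain ⟨d, hd⟩ := h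
  intro hf
  have := hd i hi
  rw [hf] at this
  omega

lemma ranked_two {r : Fin n} {f : Fin n → Fin n} (h : Ranked r f) {i : Fin n} (hi : i ≠ r)
    (hfi : f i ≠ r) : f (f i) ≠ i := by
  obtain ⟨d, hd⟩ := h
  intro hf
  have h1 := hd i hi
  have h2 := hd (f i) hfi
  rw [hf] at h2
  omega

lemma ptr_inj {r : Fin n} {f g : Fin n → Fin n} (hf : Ranked r f)
    (hfr : f r = r) (hgr : g r = r) (h : ptrGraph r f = ptrGraph r g) : f = g := by
  have hf' := hf
  obtain ⟨d, hd⟩ := hf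
  funext i
  induction hk : d i using Nat.strong_induction_on generalizing i with
  | _ k ih =>
    by_cases hi : i = r
    · rw [hi, hfr, hgr]
    have hadj : (ptrGraph r f).Adj i (f i) := by
      rw [ptrGraph, SimpleGraph.fromEdgeSet_adj]
      exact ⟨⟨i, hi, rfl⟩, (ranked_ne hf' hi).symm⟩
    rw [h, ptrGraph, SimpleGraph.fromEdgeSet_adj] at hadj
    obtain ⟨⟨j, hj, hje⟩, -⟩ := hadj
    rcases Sym2.eq_iff.1 hje with ⟨h1, h2⟩ | ⟨h1, h2⟩
    · rw [h1] at h2; exact h2.symm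
    · rw [h1] at h2 hj
      have := ih (d (f i)) (hk ▸ hd i hi) (f i) rfl
      exact absurd (this.trans h2) (ranked_two hf' hi hj)

lemma ptr_edgeSet {r : Fin n} {f : Fin n → Fin n} (hf : Ranked r f) :
    (ptrGraph r f).edgeSet = ((Finset.univ.erase r).image fun i => s(i, f i) : Finset _) := by
  ext e
  rw [ptrGraph, SimpleGraph.edgeSet_fromEdgeSet]
  simp only [Set.mem_sdiff, Set.mem_ofPred_eq, Finset.coe_image, Finset.coe_erase, Finset.coe_univ,
    Set.mem_image, Set.mem_univ, true_and, Set.mem_singleton_iff]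
  constructor
  · rintro ⟨h, -⟩; exact h
  · rintro ⟨i, hi, rfl⟩
    refine ⟨⟨i, hi, rfl⟩, ?_⟩
    intro hd
    exact ranked_ne hf hi (Sym2.mk_isDiag_iff.1 hd).symm

lemma ptr_injOn {r : Fin n} {f : Fin n → Fin n} (hf : Ranked r f) :
    Set.InjOn (fun i => s(i, f i)) ((Finset.univ.erase r : Finset (Fin n)) : Set (Fin n)) := by
  intro i hi j hj hij
  have hi : i ≠ r := by simpa using hi
  have hj : j ≠ r := by simpa using hj
  rcases Sym2.eq_iff.1 hij with ⟨h1, -⟩ | ⟨h1, h2⟩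
  · exact h1
  · exfalso
    refine ranked_two hf hi (h2 ▸ hj) ?_
    rw [h2, ← h1]

lemma ptr_isTree {r : Fin n} {f : Fin n → Fin n} (hf : Ranked r f) : (ptrGraph r f).IsTree := by
  rw [SimpleGraph.isTree_iff_connected_and_card]
  constructor
  · have hreach : ∀ i, (ptrGraph r f).Reachable i r := by
      obtain ⟨d, hd⟩ := id hf
      intro i
      induction hk : d i using Nat.strong_induction_on generalizing i with
      | _ k ih =>
        by_cases hi : i = r
        · rw [hi]
        have hadj : (ptrGraph r f).Adj i (f i) := by
          rw [ptrGraph, SimpleGraph.fromEdgeSet_adj]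
          exact ⟨⟨i, hi, rfl⟩, (ranked_ne hf hi).symm⟩
        exact hadj.reachable.trans (ih (d (f i)) (hk ▸ hd i hi) (f i) rfl)
    have : Nonempty (Fin n) := ⟨r⟩
    exact ⟨fun i j => (hreach i).trans (hreach j).symm⟩
  · rw [ptr_edgeSet hf, Nat.card_coe_set_eq, Set.ncard_coe_finset,
      Finset.card_image_of_injOn (ptr_injOn hf), Finset.card_erase_of_mem (Finset.mem_univ _)]
    have : 0 < n := r.pos
    simp
    omega

lemma adj_le_tree (G : SimpleGraph (Fin n)) [DecidableRel G.Adj]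
    (w : Sym2 (Fin n) → ℝ) (hw : ∀ e ∈ G.edgeSet, 0 < w e) (r : Fin n) :
    (glap G w).adjugate r r ≤ treeCount G w := by
  classical
  rw [adj_expand]
  set S : Finset (Fin n → Fin n) :=
    Finset.univ.filter fun f => f r = r ∧ (∀ i, i ≠ r → G.Adj i (f i)) ∧ Ranked r f with hS
  set val : SimpleGraph (Fin n) → ℝ := fun H =>
    if H ≤ G ∧ H.IsTree then ∏ e ∈ H.edgeFinset, w e else 0 with hval
  have hT : treeCount G w = ∑ H, val H := by
    unfold treeCount
    refine Finset.sum_congr rfl fun H _ => ?_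
    simp only [hval]
  have h1 : ∑ f : Fin n → Fin n,
      (∏ i, coefC G w r i (f i)) * (Matrix.of fun i => rowV r i (f i)).det =
      ∑ f ∈ S, val (ptrGraph r f) := by
    rw [← Finset.sum_subset (Finset.subset_univ S)]
    · refine Finset.sum_congr rfl fun f hf => ?_
      obtain ⟨hr, ha, hrk⟩ := (Finset.mem_filter.1 hf).2
      rw [det_ranked r f hrk, mul_one]
      have hle : ptrGraph r f ≤ G := by
        intro a b hab
        rw [ptrGraph, SimpleGraph.fromEdgeSet_adj] at hab
        obtain ⟨⟨j, hj, hje⟩, -⟩ := hab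
        have := ha j hj
        rwa [← SimpleGraph.mem_edgeSet, hje] at this
      have hE : (ptrGraph r f).edgeFinset = (Finset.univ.erase r).image fun i => s(i, f i) := by
        rw [← Finset.coe_inj, SimpleGraph.coe_edgeFinset, ptr_edgeSet hrk]
      simp only [hval]
      rw [if_pos ⟨hle, ptr_isTree hrk⟩, hE, Finset.prod_image (ptr_injOn hrk),
        ← Finset.mul_prod_erase _ _ (Finset.mem_univ r)]
      simp only [coefC, hr, if_true, one_mul]
      refine Finset.prod_congr rfl fun i hi => ?_
      have hi := Finset.ne_of_mem_erase hi
      rw [if_neg hi, cw, if_pos (ha i hi)]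
    · intro f _ hf
      by_cases hrk : Ranked r f
      · have : ∏ i, coefC G w r i (f i) = 0 := by
          by_contra hne
          have hne := Finset.prod_ne_zero_iff.1 hne
          apply hf
          refine Finset.mem_filter.2 ⟨Finset.mem_univ _, ?_, ?_, hrk⟩
          · by_contra hr
            exact hne r (Finset.mem_univ _) (by simp [coefC, hr])
          · intro i hi
            by_contra hr
            exact hne i (Finset.mem_univ _) (by simp [coefC, cw, hr, hi])
        rw [this, zero_mul]
      · rw [det_not_ranked r f hrk, mul_zero]
  rw [h1, hT, ← Finset.sum_image (f := val) (g := ptrGraph r)]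
  · refine Finset.sum_le_sum_of_subset_of_nonneg (Finset.subset_univ _) fun H _ _ => ?_
    simp only [hval]
    split_ifs with h
    · refine Finset.prod_nonneg fun e he => (hw e ?_).le
      exact SimpleGraph.edgeSet_mono h.1 (SimpleGraph.mem_edgeFinset.1 he)
    · exact le_rfl
  · intro f hf g hg hfg
    obtain ⟨hr, ha, hrk⟩ := (Finset.mem_filter.1 hf).2
    obtain ⟨hr', ha', hrk'⟩ := (Finset.mem_filter.1 hg).2
    exact ptr_inj hrk hr hr' hfg

end

/-- For a connected weighted graph,
`ρ_ss(G) ≥ (n-1) / (2 (n T(G))^{1/(n-1)})` where `T(G)` counts weighted spanning trees. -/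
theorem stmt7 {n : ℕ} (G : SimpleGraph (Fin n)) [DecidableRel G.Adj]
    (w : Sym2 (Fin n) → ℝ) (hw : ∀ e ∈ G.edgeSet, 0 < w e) (hG : G.Connected) :
    ((n : ℝ) - 1) / (2 * ((n : ℝ) * treeCount G w) ^ ((1 : ℝ) / ((n : ℝ) - 1)))
      ≤ wRho G w := by
  have hnn : ∀ i, 0 ≤ wEig G w i := fun i => (glap_psd G w hw).eigenvalues_nonneg i
  obtain ⟨i0, hi0⟩ := exists_zero_eig G w hG
  have hn0 : 0 < n := i0.pos
  have hpos : ∀ i ∈ Finset.univ.erase i0, 0 < wEig G w i := fun i hi =>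
    lt_of_le_of_ne (hnn i) fun h =>
      Finset.ne_of_mem_erase hi (unique_zero_eig G w hw hG i i0 h.symm hi0)
  set P := ∏ i ∈ Finset.univ.erase i0, wEig G w i with hP
  have hPpos : 0 < P := Finset.prod_pos hpos
  have hPle : P ≤ n * treeCount G w := by
    calc P ≤ ∑ i, ∏ j ∈ Finset.univ.erase i, wEig G w j :=
          Finset.single_le_sum (f := fun i => ∏ j ∈ Finset.univ.erase i, wEig G w j)
            (fun i _ => Finset.prod_nonneg fun j _ => hnn j) (Finset.mem_univ i0)
      _ = (glap G w).adjugate.trace := (trace_adj _ (glap_isHermitian G w)).symm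
      _ ≤ ∑ _r : Fin n, treeCount G w := Finset.sum_le_sum fun r _ => adj_le_tree G w hw r
      _ = n * treeCount G w := by simp
  have hsum : ∑ i, (wEig G w i)⁻¹ = ∑ i ∈ Finset.univ.erase i0, (wEig G w i)⁻¹ := by
    rw [← Finset.add_sum_erase _ _ (Finset.mem_univ i0), hi0, _root_.inv_zero, zero_add]
  have hS0 : 0 ≤ ∑ i ∈ Finset.univ.erase i0, (wEig G w i)⁻¹ :=
    Finset.sum_nonneg fun i _ => inv_nonneg.2 (hnn i)
  rw [wRho, hsum]
  rcases Nat.lt_or_ge 1 n with hn | hn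
  · have hm : (0 : ℝ) < (n : ℝ) - 1 := by
      have : (1 : ℝ) < n := by exact_mod_cast hn
      linarith
    have hcard : ∑ _i ∈ Finset.univ.erase i0, (1 : ℝ) = (n : ℝ) - 1 := by
      rw [Finset.sum_const, Finset.card_erase_of_mem (Finset.mem_univ _)]
      simp [Nat.cast_sub hn0]
    have ham := Real.geom_mean_le_arith_mean (Finset.univ.erase i0) (fun _ => (1 : ℝ))
      (fun i => (wEig G w i)⁻¹) (fun _ _ => zero_le_one) (by rw [hcard]; exact hm)
      (fun i _ => inv_nonneg.2 (hnn i))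
    simp only [hcard, Real.rpow_one, one_mul, Finset.prod_inv_distrib] at ham
    rw [← hP, Real.inv_rpow hPpos.le, le_div_iff₀ hm] at ham
    have hmono : P ^ ((n : ℝ) - 1)⁻¹ ≤ (n * treeCount G w) ^ ((n : ℝ) - 1)⁻¹ :=
      Real.rpow_le_rpow hPpos.le hPle (inv_nonneg.2 hm.le)
    have hp : 0 < P ^ ((n : ℝ) - 1)⁻¹ := Real.rpow_pos_of_pos hPpos _
    rw [one_div ((n : ℝ) - 1)]
    calc ((n : ℝ) - 1) / (2 * (n * treeCount G w) ^ ((n : ℝ) - 1)⁻¹)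
        ≤ ((n : ℝ) - 1) / (2 * P ^ ((n : ℝ) - 1)⁻¹) := by gcongr
      _ = 1 / 2 * ((P ^ ((n : ℝ) - 1)⁻¹)⁻¹ * ((n : ℝ) - 1)) := by field_simp
      _ ≤ _ := by gcongr
  · have : n = 1 := by omega
    have h1 : (n : ℝ) - 1 = 0 := by rw [this]; simp
    rw [h1, zero_div]
    positivity
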